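/- There exists an element e ∈ M such that e·m = m = m·e for all m ∈ M (in particular e² = e, so e is an idempotent serving as a two-sided unit of the ideal M), and M = { e·a·e : a ∈ A_n^{t_n}(d) }. -/

import Mathlib

/-- The permutation operator `V(σ)` on `(ℂ^d)^{⊗ n}`, realized as the square matrix
indexed by functions `f g : Fin n → Fin d`, with entry `1` if `g = f ∘ σ` and `0` otherwise. -/
noncomputable def V (n d : ℕ) (σ : Equiv.Perm (Fin n)) :
    Matrix (Fin n → Fin d) (Fin n → Fin d) ℂ :=
  Matrix.of fun f g => if g = f ∘ σ then 1 else 0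

/-- Partial transpose of a matrix on `(ℂ^d)^{⊗ n}` at position `p`. -/
noncomputable def pt {n d : ℕ} (p : Fin n)
    (A : Matrix (Fin n → Fin d) (Fin n → Fin d) ℂ) :
    Matrix (Fin n → Fin d) (Fin n → Fin d) ℂ :=
  Matrix.of fun f g =>
    A (Function.update f p (g p)) (Function.update g p (f p))

/-- The last position `n` of the tensor product, as an element of `Fin n`. -/
def lastIdx (n : ℕ) (hn : 1 ≤ n) : Fin n := ⟨n - 1, by omega⟩
/-- The algebra `A_n^{t_n}(d)`: the `ℂ`-linear span of `{V(σ)^{t_n} : σ ∈ S(n)}`. -/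
noncomputable def Aspan (n d : ℕ) (hn : 1 ≤ n) :
    Submodule ℂ (Matrix (Fin n → Fin d) (Fin n → Fin d) ℂ) :=
  Submodule.span ℂ (Set.range fun σ : Equiv.Perm (Fin n) => pt (lastIdx n hn) (V n d σ))

/-- The ideal `M`: the `ℂ`-linear span of `{V(σ)^{t_n} : σ ∈ S(n), σ(n) ≠ n}`. -/
noncomputable def Mid (n d : ℕ) (hn : 1 ≤ n) :
    Submodule ℂ (Matrix (Fin n → Fin d) (Fin n → Fin d) ℂ) :=
  Submodule.span ℂ
    {x | ∃ σ : Equiv.Perm (Fin n), σ (lastIdx n hn) ≠ lastIdx n hn ∧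
      x = pt (lastIdx n hn) (V n d σ)}

open Matrix Equiv

section PartialTranspose

variable {n d : ℕ} {p : Fin n}

theorem V_mul_apply (α : Perm (Fin n)) (A : Matrix (Fin n → Fin d) (Fin n → Fin d) ℂ)
    (f g : Fin n → Fin d) : (V n d α * A) f g = A (f ∘ α) g := by
  simp [V, Matrix.mul_apply]

theorem mul_V_apply (α : Perm (Fin n)) (A : Matrix (Fin n → Fin d) (Fin n → Fin d) ℂ)
    (f g : Fin n → Fin d) : (A * V n d α) f g = A f (g ∘ α.symm) := by
  have h (k : Fin n → Fin d) : g = k ∘ α ↔ g ∘ α.symm = k := by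
    rw [Equiv.comp_symm_eq]
  simp [V, Matrix.mul_apply, h]

theorem pt_V_of_fixed {α : Perm (Fin n)} (hα : α p = p) : pt p (V n d α) = V n d α := by
  ext f g
  simp only [pt, V, Matrix.of_apply]
  congr 1
  simp only [funext_iff, Function.comp_apply, Function.update_apply, eq_iff_iff]
  refine forall_congr' fun i => ?_
  by_cases hi : i = p
  · subst hi
    simp [hα, eq_comm]
  · have : α i ≠ p := fun h => hi (α.injective (h.trans hα.symm))
    simp [hi, this]

theorem V_mul_pt_V {α : Perm (Fin n)} (hα : α p = p) (τ : Perm (Fin n)) :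
    V n d α * pt p (V n d τ) = pt p (V n d (α * τ)) := by
  ext f g
  rw [V_mul_apply]
  have h : Function.update (f ∘ α) p (g p) = Function.update f p (g p) ∘ α := by
    rw [Function.update_comp_equiv, α.symm_apply_eq.mpr hα.symm]
  simp only [pt, V, Matrix.of_apply, h, Function.comp_apply, hα, Function.comp_assoc,
    Equiv.Perm.coe_mul]
  congr

theorem pt_conjTranspose (A : Matrix (Fin n → Fin d) (Fin n → Fin d) ℂ) :
    (pt p A)ᴴ = pt p Aᴴ := rfl

theorem V_conjTranspose (σ : Perm (Fin n)) : (V n d σ)ᴴ = V n d σ⁻¹ := by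
  ext f g
  have h : f = g ∘ σ ↔ g = f ∘ σ.symm := by
    constructor <;> rintro rfl <;> ext <;> simp
  simp [V, Matrix.conjTranspose_apply, h, apply_ite, Equiv.Perm.inv_def]

theorem pt_V_conjTranspose (σ : Perm (Fin n)) :
    (pt p (V n d σ))ᴴ = pt p (V n d σ⁻¹) := by
  rw [pt_conjTranspose, V_conjTranspose]

theorem pt_V_mul_V {α : Perm (Fin n)} (hα : α p = p) (τ : Perm (Fin n)) :
    pt p (V n d τ) * V n d α = pt p (V n d (τ * α)) := by
  have hα' : α⁻¹ p = p := by rw [Equiv.Perm.inv_eq_iff_eq, hα]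
  apply Matrix.conjTranspose_injective
  rw [Matrix.conjTranspose_mul, pt_V_conjTranspose, pt_V_conjTranspose, V_conjTranspose,
    V_mul_pt_V hα', _root_.mul_inv_rev]

theorem pt_V_swap_apply {x : Fin n} (hx : x ≠ p) (f g : Fin n → Fin d) :
    pt p (V n d (swap p x)) f g =
      if f p = f x ∧ g p = g x ∧ ∀ i, i ≠ p → i ≠ x → g i = f i then 1 else 0 := by
  simp only [pt, V, Matrix.of_apply]
  congr 1
  simp only [funext_iff, Function.comp_apply, Function.update_apply, eq_iff_iff]
  constructor
  · intro h
    refine ⟨by simpa [hx] using h p, by simpa [hx, eq_comm] using h x, fun i hp hi => ?_⟩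
    simpa [hp, hi, swap_apply_of_ne_of_ne] using h i
  · rintro ⟨h1, h2, h3⟩ i
    by_cases hp : i = p
    · subst hp; simpa [hx] using h1
    by_cases hi : i = x
    · subst hi; simp [hp, h2]
    simp [hp, hi, swap_apply_of_ne_of_ne, h3]

theorem pt_V_swap_mul_apply {x : Fin n} (hx : x ≠ p)
    (A : Matrix (Fin n → Fin d) (Fin n → Fin d) ℂ) (f g : Fin n → Fin d) :
    (pt p (V n d (swap p x)) * A) f g =
      if f p = f x then ∑ k, A (Function.update (Function.update f p k) x k) g else 0 := by
  have key (h : Fin n → Fin d) : pt p (V n d (swap p x)) f h =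
      if f p = f x then
        ∑ k, if h = Function.update (Function.update f p k) x k then 1 else 0 else 0 := by
    rw [pt_V_swap_apply hx]
    split_ifs with h1 h2 h2
    · rw [Finset.sum_eq_single (h p)]
      · rw [if_pos]
        ext i
        grind [Function.update_apply]
      · intro k _ hk
        rw [if_neg]
        rintro rfl
        simp [hx.symm] at hk
      · simp
    · exact absurd h1.1 h2
    · symm
      refine Finset.sum_eq_zero fun k _ => if_neg ?_
      rintro rfl
      refine h1 ⟨h2, by simp [hx.symm], fun i hp hi => by simp [hp, hi]⟩
    · rfl
  simp only [Matrix.mul_apply, key]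
  split_ifs with h
  · simp only [Finset.sum_mul]
    rw [Finset.sum_comm]
    simp
  · simp

theorem pt_V_swap_mul_self {x : Fin n} (hx : x ≠ p) :
    pt p (V n d (swap p x)) * pt p (V n d (swap p x)) = (d : ℂ) • pt p (V n d (swap p x)) := by
  ext f g
  rw [pt_V_swap_mul_apply hx]
  simp only [Matrix.smul_apply, pt_V_swap_apply hx]
  have (k : Fin d) : (∀ i, i ≠ p → i ≠ x →
      g i = Function.update (Function.update f p k) x k i) ↔
        ∀ i, i ≠ p → i ≠ x → g i = f i := by
    refine forall_congr' fun i => forall_congr' fun hp => forall_congr' fun hi => ?_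
    simp [hp, hi]
  simp only [this]
  by_cases h : f p = f x <;> simp [h, hx.symm]

theorem pt_V_swap_mul_pt_V_swap {x y : Fin n} (hx : x ≠ p) (hy : y ≠ p) (hxy : x ≠ y) :
    pt p (V n d (swap p x)) * pt p (V n d (swap p y)) =
      pt p (V n d (swap p x * swap x y)) := by
  rw [← pt_V_mul_V (swap_apply_of_ne_of_ne hx.symm hy.symm)]
  ext f g
  rw [pt_V_swap_mul_apply hx, mul_V_apply]
  simp only [pt_V_swap_apply hx, pt_V_swap_apply hy]
  by_cases h : f p = f x
  · rw [if_pos h, Finset.sum_eq_single (f y)]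
    · congr 1
      simp only [eq_iff_iff, Function.comp_apply, symm_swap, Function.update_apply]
      constructor
      · rintro ⟨h1, h2, h3⟩
        grind
      · rintro ⟨h1, h2, h3⟩
        have := h3 y hy hxy.symm
        refine ⟨by grind, by grind, fun i hp hi => ?_⟩
        have := h3 i hp
        grind
    · intro k _ hk
      rw [if_neg]
      rintro ⟨h1, -⟩
      apply hk
      simpa [hx.symm, hxy.symm, hy] using h1
    · simp
  · simp [h]

theorem pt_V_mul_pt_V_mem {σ τ : Perm (Fin n)} (hσ : σ p ≠ p) (hτ : τ p ≠ p) :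
    pt p (V n d σ) * pt p (V n d τ) ∈ Submodule.span ℂ
      {x | ∃ ρ : Perm (Fin n), ρ p ≠ p ∧ x = pt p (V n d ρ)} := by
  set a := σ⁻¹ p with ha
  set c := τ p with hc
  have hσa : σ a = p := by simp [ha]
  have hap : a ≠ p := fun h => hσ (by rw [← h, hσa, h])
  obtain ⟨α, hα⟩ : ∃ α, α = σ * swap p a := ⟨_, rfl⟩
  obtain ⟨β, hβ⟩ : ∃ β, β = swap p c * τ := ⟨_, rfl⟩
  have hαp : α p = p := by simp [hα, hσa]
  have hβp : β p = p := by simp [hβ, ← hc]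
  have hσ' : σ = α * swap p a := by simp [hα, mul_assoc]
  have hτ' : τ = swap p c * β := by simp [hβ]
  have hαa : α a ≠ p := fun h => hap (α.injective (h.trans hαp.symm))
  rw [hσ', hτ', ← V_mul_pt_V hαp, ← pt_V_mul_V hβp, mul_assoc, ← mul_assoc (pt p _) (pt p _)]
  by_cases hac : a = c
  · rw [← hac, pt_V_swap_mul_self hap, Matrix.smul_mul, Matrix.mul_smul, pt_V_mul_V hβp,
      V_mul_pt_V hαp]
    exact Submodule.smul_mem _ _ (Submodule.subset_span ⟨_, by simp [hβp, hαa], rfl⟩)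
  · rw [pt_V_swap_mul_pt_V_swap hap hτ hac, pt_V_mul_V hβp, V_mul_pt_V hαp]
    refine Submodule.subset_span ⟨_, ?_, rfl⟩
    simp [hβp, swap_apply_of_ne_of_ne hap.symm hτ.symm, hαa]

end PartialTranspose

section StarClosed

open scoped ComplexOrder

variable {m : Type*} [Fintype m]

theorem sum_mul_conjTranspose_eq_zero {ι : Type*} {s : Finset ι} {A : ι → Matrix m m ℂ}
    (h : ∑ i ∈ s, A i * (A i)ᴴ = 0) {i : ι} (hi : i ∈ s) : A i = 0 := by
  have htr : ∑ i ∈ s, (A i * (A i)ᴴ).trace = 0 := by rw [← Matrix.trace_sum, h, Matrix.trace_zero]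
  have hpos (i) (_ : i ∈ s) : 0 ≤ (A i * (A i)ᴴ).trace :=
    (Matrix.posSemidef_self_mul_conjTranspose _).trace_nonneg
  exact Matrix.trace_mul_conjTranspose_self_eq_zero_iff.mp
    ((Finset.sum_eq_zero_iff_of_nonneg hpos).mp htr i hi)

/-- A subspace of square complex matrices closed under multiplication and conjugate transpose
has a two-sided unit. -/
theorem Submodule.exists_unit_of_conjTranspose_mem (M : Submodule ℂ (Matrix m m ℂ))
    (hmul : ∀ a ∈ M, ∀ b ∈ M, a * b ∈ M) (hstar : ∀ a ∈ M, aᴴ ∈ M) :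
    ∃ e ∈ M, ∀ a ∈ M, e * a = a ∧ a * e = a := by
  classical
  obtain ⟨s, hs⟩ := IsNoetherian.noetherian M
  have hsM {a} (ha : a ∈ s) : a ∈ M := hs ▸ Submodule.subset_span ha
  set T : Matrix m m ℂ := ∑ a ∈ s, a * aᴴ
  have hT : T ∈ M := M.sum_mem fun a ha => hmul _ (hsM ha) _ (hstar _ (hsM ha))
  have key (y : Matrix m m ℂ) (hy : y * T = 0) : ∀ a ∈ M, y * a = 0 := by
    have h0 : ∑ a ∈ s, (y * a) * (y * a)ᴴ = 0 := by
      have : y * T * yᴴ = 0 := by rw [hy, zero_mul]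
      simpa [T, Finset.mul_sum, Finset.sum_mul, mul_assoc, Matrix.conjTranspose_mul] using this
    intro a ha
    rw [← hs] at ha
    induction ha using Submodule.span_induction with
    | mem a ha => exact sum_mul_conjTranspose_eq_zero h0 ha
    | zero => simp
    | add a b _ _ ha hb => rw [mul_add, ha, hb, add_zero]
    | smul c a _ ha => rw [Matrix.mul_smul, ha, smul_zero]
  let R : M →ₗ[ℂ] M := (LinearMap.mulRight ℂ T).restrict fun a ha => hmul a ha T hT
  have hR : Function.Injective R := by
    rw [← LinearMap.ker_eq_bot, LinearMap.ker_eq_bot']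
    rintro ⟨x, hx⟩ h
    have hxT : x * T = 0 := congrArg Subtype.val h
    exact Subtype.ext
      (Matrix.self_mul_conjTranspose_eq_zero.mp (key x hxT _ (hstar x hx)))
  obtain ⟨⟨e, he⟩, heT⟩ := LinearMap.injective_iff_surjective.mp hR ⟨T, hT⟩
  have heT : e * T = T := congrArg Subtype.val heT
  have hleft (a) (ha : a ∈ M) : e * a = a := by
    have := key (e - 1) (by rw [sub_mul, heT, one_mul, sub_self]) a ha
    rwa [sub_mul, one_mul, sub_eq_zero] at this
  have hright (a) (ha : a ∈ M) : a * eᴴ = a := by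
    simpa using congrArg Matrix.conjTranspose (hleft _ (hstar a ha))
  have hself : eᴴ = e := (hleft _ (hstar e he)).symm.trans (hright e he)
  exact ⟨e, he, fun a ha => ⟨hleft a ha, by simpa [hself] using hright a ha⟩⟩

end StarClosed

theorem Aspan_mul_Mid_mem {n d : ℕ} {hn : 1 ≤ n} {a b : Matrix (Fin n → Fin d) (Fin n → Fin d) ℂ}
    (ha : a ∈ Aspan n d hn) (hb : b ∈ Mid n d hn) : a * b ∈ Mid n d hn := by
  have h : Aspan n d hn * Mid n d hn ≤ Mid n d hn := by
    rw [Aspan, Mid, Submodule.span_mul_span, Submodule.span_le]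
    rintro _ ⟨_, ⟨σ, rfl⟩, _, ⟨τ, hτ, rfl⟩, rfl⟩
    by_cases hσ : σ (lastIdx n hn) = lastIdx n hn
    · simp only [pt_V_of_fixed hσ, V_mul_pt_V hσ]
      refine Submodule.subset_span ⟨_, fun h => hτ (σ.injective ?_), rfl⟩
      rw [hσ, ← Equiv.Perm.mul_apply, h]
    · exact pt_V_mul_pt_V_mem hσ hτ
  exact h (Submodule.mul_mem_mul ha hb)

theorem Mid_le_Aspan (n d : ℕ) (hn : 1 ≤ n) : Mid n d hn ≤ Aspan n d hn := by
  refine Submodule.span_mono ?_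
  rintro _ ⟨σ, -, rfl⟩
  exact ⟨σ, rfl⟩

theorem Mid_conjTranspose_mem {n d : ℕ} {hn : 1 ≤ n}
    {a : Matrix (Fin n → Fin d) (Fin n → Fin d) ℂ} (ha : a ∈ Mid n d hn) : aᴴ ∈ Mid n d hn := by
  induction ha using Submodule.span_induction with
  | mem a ha =>
    obtain ⟨σ, hσ, rfl⟩ := ha
    rw [pt_V_conjTranspose]
    exact Submodule.subset_span ⟨_, by rwa [Ne, Equiv.Perm.inv_eq_iff_eq, eq_comm], rfl⟩
  | zero => simp
  | add a b _ _ ha hb => simpa using add_mem ha hb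
  | smul c a _ ha => simpa using Submodule.smul_mem _ _ ha

/-- The ideal `M` has a two-sided unit `e` (an idempotent of the algebra), and
`M = e · A_n^{t_n}(d) · e`. -/
theorem M_has_unit (n d : ℕ) (hn : 1 ≤ n) (hd : 1 ≤ d) :
    ∃ e ∈ Mid n d hn,
      (∀ m ∈ Mid n d hn, e * m = m ∧ m * e = m) ∧
      (Mid n d hn : Set (Matrix (Fin n → Fin d) (Fin n → Fin d) ℂ)) =
        (fun a => e * a * e) '' (Aspan n d hn : Set (Matrix (Fin n → Fin d) (Fin n → Fin d) ℂ)) := by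
  obtain ⟨e, he, hunit⟩ := (Mid n d hn).exists_unit_of_conjTranspose_mem
    (fun a ha b hb => Aspan_mul_Mid_mem (Mid_le_Aspan n d hn ha) hb)
    (fun a ha => Mid_conjTranspose_mem ha)
  refine ⟨e, he, hunit, Set.Subset.antisymm (fun a ha => ?_) ?_⟩
  · exact ⟨a, Mid_le_Aspan n d hn ha, by simp [hunit a ha]⟩
  · rintro _ ⟨a, ha, rfl⟩
    have hae := Aspan_mul_Mid_mem ha he
    change e * a * e ∈ Mid n d hn
    rwa [mul_assoc, (hunit _ hae).1]
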